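/- arXiv:2008.08392 — 2 statements merged into one kernel-verified Lean document; each statement's English description precedes it below -/
import Mathlib

section
/- There are exactly 105 *-sets. -/
open Matrix

noncomputable section

/-- Gram matrix of the even lattice `2U(4) ⊕ A₁`. -/
def GramA : Matrix (Fin 5) (Fin 5) ℚ :=
  !![0,0,0,0,4; 0,0,0,4,0; 0,0,2,0,0; 0,4,0,0,0; 4,0,0,0,0]

/-- The bilinear form on `V = ℚ⁵` with Gram matrix `GramA`. -/
def BA (x y : Fin 5 → ℚ) : ℚ := x ⬝ᵥ GramA.mulVec y

/-- The lattice `M = ℤ⁵ ⊆ ℚ⁵`. -/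
def MA : AddSubgroup (Fin 5 → ℚ) where
  carrier := {x | ∀ i, ∃ n : ℤ, x i = (n : ℚ)}
  zero_mem' := fun i => ⟨0, by simp⟩
  add_mem' := by
    intro a b ha hb i
    obtain ⟨n, hn⟩ := ha i
    obtain ⟨m, hm⟩ := hb i
    exact ⟨n + m, by simp [hn, hm]⟩
  neg_mem' := by
    intro a ha i
    obtain ⟨n, hn⟩ := ha i
    exact ⟨-n, by simp [hn]⟩

/-- The dual lattice `M^∨ = {x ∈ V : B(x,m) ∈ ℤ for all m ∈ M}`. -/
def MAdual : Set (Fin 5 → ℚ) := {x | ∀ m ∈ MA, ∃ n : ℤ, BA x m = (n : ℚ)}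

/-- The discriminant group `M^∨/M` lives inside `V/M`. -/
abbrev QA := (Fin 5 → ℚ) ⧸ MA

/-- The projection `V → V/M`. -/
def pA : (Fin 5 → ℚ) → QA := QuotientAddGroup.mk

/-- A type II class: an unordered pair `{u+M, −u+M}` of cosets of order 4 in `M^∨/M`
with a representative `u` satisfying `B(u,u) = 1/2`. -/
def IsTypeII (c : Sym2 QA) : Prop :=
  ∃ u : Fin 5 → ℚ, u ∈ MAdual ∧ addOrderOf (pA u) = 4 ∧ BA u u = 1/2 ∧
    c = s(pA u, pA (-u))

/-- The reflection `σ_u(x) = x − 4·B(u,x)·u` (for `B(u,u) = 1/2`). -/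
def reflA (u x : Fin 5 → ℚ) : Fin 5 → ℚ := x - (4 * BA u x) • u

/-- A `*`-set: four distinct type II classes such that `σ_u(u') ∈ (u'+M) ∪ (−u'+M)`
whenever `u, u' ∈ M^∨` have `B(u,u) = B(u',u') = 1/2` and represent cosets of
(possibly equal) classes of the set. -/
def IsStarSet (S : Set (Sym2 QA)) : Prop :=
  S.ncard = 4 ∧ (∀ c ∈ S, IsTypeII c) ∧
  ∀ u u' : Fin 5 → ℚ, u ∈ MAdual → u' ∈ MAdual →
    BA u u = 1/2 → BA u' u' = 1/2 →
    (∃ c ∈ S, pA u ∈ c) → (∃ c' ∈ S, pA u' ∈ c') →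
    (reflA u u' - u' ∈ MA ∨ reflA u u' + u' ∈ MA)



structure Z5 where
  a : ℤ
  b : ℤ
  c : ℤ
  d : ℤ
  e : ℤ

/-- The point of the dual lattice with given integer coordinates. -/
def emb (z : Z5) : Fin 5 → ℚ := ![z.a / 4, z.b / 4, z.c / 2, z.d / 4, z.e / 4]

def Z5.neg (z : Z5) : Z5 := ⟨-z.a, -z.b, -z.c, -z.d, -z.e⟩

def Z5.t (z w : Z5) : ℤ := z.a * w.e + z.b * w.d + z.d * w.b + z.e * w.a + 2 * z.c * w.c

def Z5.lat (z : Z5) : Prop := 4 ∣ z.a ∧ 4 ∣ z.b ∧ 2 ∣ z.c ∧ 4 ∣ z.d ∧ 4 ∣ z.e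

instance (z : Z5) : Decidable z.lat := by unfold Z5.lat; infer_instance

def Z5.comb (m : ℤ) (z : Z5) (n : ℤ) (w : Z5) : Z5 :=
  ⟨m * z.a + n * w.a, m * z.b + n * w.b, m * z.c + n * w.c, m * z.d + n * w.d, m * z.e + n * w.e⟩

def Z5.C (z w : Z5) : Prop := (Z5.comb (-(z.t w)) z 0 w).lat ∨ (Z5.comb (-(z.t w)) z 2 w).lat

instance (z w : Z5) : Decidable (z.C w) := by unfold Z5.C; infer_instance

def Z5.odd (z : Z5) : Prop := ¬ (2 ∣ z.a ∧ 2 ∣ z.b ∧ 2 ∣ z.d ∧ 2 ∣ z.e)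

instance (z : Z5) : Decidable z.odd := by unfold Z5.odd; infer_instance

lemma emb_comb (m n : ℤ) (z w : Z5) :
    emb (Z5.comb m z n w) = (m : ℚ) • emb z + (n : ℚ) • emb w := by
  ext i
  fin_cases i <;> simp [emb, Z5.comb] <;> ring

lemma emb_neg (z : Z5) : emb z.neg = - emb z := by
  ext i
  fin_cases i <;> simp [emb, Z5.neg] <;> ring

lemma int_div_four (a : ℤ) : (∃ n : ℤ, (a : ℚ) / 4 = n) ↔ 4 ∣ a := by
  constructor
  · rintro ⟨n, hn⟩
    refine ⟨n, ?_⟩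
    have : (a : ℚ) = 4 * n := by linarith
    exact_mod_cast this
  · rintro ⟨n, rfl⟩
    exact ⟨n, by push_cast; ring⟩

lemma int_div_two (a : ℤ) : (∃ n : ℤ, (a : ℚ) / 2 = n) ↔ 2 ∣ a := by
  constructor
  · rintro ⟨n, hn⟩
    refine ⟨n, ?_⟩
    have : (a : ℚ) = 2 * n := by linarith
    exact_mod_cast this
  · rintro ⟨n, rfl⟩
    exact ⟨n, by push_cast; ring⟩

lemma emb_mem (z : Z5) : emb z ∈ MA ↔ z.lat := by
  change (∀ i, ∃ n : ℤ, emb z i = (n : ℚ)) ↔ _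
  simp only [Fin.forall_fin_succ, emb, Z5.lat]
  simp [int_div_four, int_div_two]

lemma BA_eq (x y : Fin 5 → ℚ) : BA x y =
    4 * (x 0 * y 4 + x 1 * y 3 + x 3 * y 1 + x 4 * y 0) + 2 * x 2 * y 2 := by
  simp [BA, GramA, Matrix.mulVec, dotProduct, Fin.sum_univ_succ]
  ring

lemma BA_emb (z w : Z5) : BA (emb z) (emb w) = (z.t w : ℚ) / 4 := by
  rw [BA_eq]
  simp [emb, Z5.t]
  ring

lemma single_mem (i : Fin 5) : (Pi.single i 1 : Fin 5 → ℚ) ∈ MA := by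
  intro j
  by_cases h : j = i
  · subst h; exact ⟨1, by simp⟩
  · exact ⟨0, by simp [h]⟩

lemma mem_dual (x : Fin 5 → ℚ) : x ∈ MAdual ↔ ∃ z, x = emb z := by
  constructor
  · intro h
    obtain ⟨e, he⟩ := h _ (single_mem 0)
    obtain ⟨d, hd⟩ := h _ (single_mem 1)
    obtain ⟨c, hc⟩ := h _ (single_mem 2)
    obtain ⟨b, hb⟩ := h _ (single_mem 3)
    obtain ⟨a, ha⟩ := h _ (single_mem 4)
    refine ⟨⟨a, b, c, d, e⟩, ?_⟩
    rw [BA_eq] at ha hb hc hd he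
    simp at ha hb hc hd he
    ext i
    fin_cases i <;> simp [emb] <;> linarith
  · rintro ⟨z, rfl⟩ m hm
    obtain ⟨m0, h0⟩ := hm 0
    obtain ⟨m1, h1⟩ := hm 1
    obtain ⟨m2, h2⟩ := hm 2
    obtain ⟨m3, h3⟩ := hm 3
    obtain ⟨m4, h4⟩ := hm 4
    refine ⟨z.a * m4 + z.b * m3 + z.d * m1 + z.e * m0 + z.c * m2, ?_⟩
    rw [BA_eq, h0, h1, h2, h3, h4]
    simp [emb]
    ring

lemma pA_eq (z w : Z5) : pA (emb z) = pA (emb w) ↔ (Z5.comb (-1) z 1 w).lat := by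
  rw [← emb_mem, emb_comb, pA, QuotientAddGroup.eq]
  simp

lemma two_smul_pA (z : Z5) : 2 • pA (emb z) = 0 ↔ ¬ z.odd := by
  have : 2 • pA (emb z) = pA (emb (Z5.comb 2 z 0 z)) := by
    rw [emb_comb]
    have h : ((2 : ℤ) : ℚ) • emb z + ((0 : ℤ) : ℚ) • emb z = 2 • emb z := by
      ext i; simp
    rw [h]; rfl
  rw [this]
  have h2 : pA (emb (Z5.comb 2 z 0 z)) = 0 ↔ emb (Z5.comb 2 z 0 z) ∈ MA :=
    QuotientAddGroup.eq_zero_iff _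
  rw [h2, emb_mem]
  simp only [Z5.lat, Z5.comb, Z5.odd]
  omega

lemma four_smul_pA (z : Z5) : 4 • pA (emb z) = 0 := by
  have : 4 • pA (emb z) = pA (emb (Z5.comb 4 z 0 z)) := by
    rw [emb_comb]
    have h : ((4 : ℤ) : ℚ) • emb z + ((0 : ℤ) : ℚ) • emb z = 4 • emb z := by
      ext i; simp
    rw [h]; rfl
  rw [this]
  refine (QuotientAddGroup.eq_zero_iff _).2 ?_
  rw [emb_mem]
  simp only [Z5.lat, Z5.comb]
  omega

lemma order_iff (z : Z5) : addOrderOf (pA (emb z)) = 4 ↔ z.odd := by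
  constructor
  · intro h
    by_contra hn
    have := addOrderOf_dvd_of_nsmul_eq_zero ((two_smul_pA z).2 hn)
    rw [h] at this
    omega
  · intro h
    have := addOrderOf_eq_prime_pow (p := 2) (n := 1) (x := pA (emb z))
      (by rw [pow_one, two_smul_pA]; simpa using h) (four_smul_pA z)
    simpa using this

/-- Same class up to sign. -/
def Z5.same (z w : Z5) : Prop := (Z5.comb (-1) z 1 w).lat ∨ (Z5.comb 1 z 1 w).lat

instance (z w : Z5) : Decidable (z.same w) := by unfold Z5.same; infer_instance

/-- The class of a vector. -/
def cls (z : Z5) : Sym2 QA := s(pA (emb z), pA (-emb z))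

lemma pA_eq_neg (z w : Z5) : pA (emb z) = pA (-emb w) ↔ (Z5.comb 1 z 1 w).lat := by
  rw [← emb_neg, pA_eq]
  simp only [Z5.lat, Z5.comb, Z5.neg]
  omega

lemma mem_cls (z w : Z5) : pA (emb z) ∈ cls w ↔ z.same w := by
  simp only [cls, Sym2.mem_iff, pA_eq, pA_eq_neg, Z5.same]

lemma cls_eq (z w : Z5) : cls z = cls w ↔ z.same w := by
  rw [← mem_cls]
  constructor
  · intro h; rw [← h]; simp [cls]
  · intro h
    have hneg : ∀ x : Fin 5 → ℚ, pA (-x) = - pA x := fun x => rfl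
    simp only [cls, Sym2.mem_iff] at h ⊢
    rcases h with h | h
    · rw [hneg, hneg, h]
    · rw [hneg, h, hneg, neg_neg]; exact Sym2.eq_swap

lemma refl_cond (z w : Z5) :
    (reflA (emb z) (emb w) - emb w ∈ MA ∨ reflA (emb z) (emb w) + emb w ∈ MA) ↔ z.C w := by
  have h1 : reflA (emb z) (emb w) - emb w = emb (Z5.comb (-(z.t w)) z 0 w) := by
    rw [emb_comb, reflA, BA_emb]
    ext i
    simp only [Pi.sub_apply, Pi.smul_apply, Pi.add_apply, smul_eq_mul]
    push_cast
    ring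
  have h2 : reflA (emb z) (emb w) + emb w = emb (Z5.comb (-(z.t w)) z 2 w) := by
    rw [emb_comb, reflA, BA_emb]
    ext i
    simp only [Pi.sub_apply, Pi.smul_apply, Pi.add_apply, smul_eq_mul]
    push_cast
    ring
  rw [h1, h2, emb_mem, emb_mem, Z5.C]

lemma mul_dvd_shift (t t' x x' m y y' : ℤ) (ht : 4 ∣ t - t' ) (hx : 4 ∣ x - x')
    (hy : 2 ∣ y - y') (hm : 2 ∣ m) : 4 ∣ -t * x + m * y ↔ 4 ∣ -t' * x' + m * y' := by
  obtain ⟨p, hp⟩ := ht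
  obtain ⟨q, hq⟩ := hx
  obtain ⟨r, hr⟩ := hy
  obtain ⟨s, rfl⟩ := hm
  have e1 : t = t' + 4 * p := by linarith
  have e2 : x = x' + 4 * q := by linarith
  have e3 : y = y' + 2 * r := by linarith
  have : -t * x + 2 * s * y = -t' * x' + 2 * s * y' +
      4 * (-p * x' - q * t' - 4 * p * q + s * r) := by
    rw [e1, e2, e3]; ring
  rw [this]; exact (Int.dvd_add_left (Dvd.intro _ rfl))

lemma mul_dvd_shift2 (t t' x x' m y y' : ℤ) (ht : 4 ∣ t - t' ) (hx : 2 ∣ x - x')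
    (hm : 2 ∣ m) : 2 ∣ -t * x + m * y ↔ 2 ∣ -t' * x' + m * y' := by
  obtain ⟨p, hp⟩ := ht
  obtain ⟨q, hq⟩ := hx
  obtain ⟨s, rfl⟩ := hm
  have e1 : t = t' + 4 * p := by linarith
  have e2 : x = x' + 2 * q := by linarith
  have : -t * x + 2 * s * y = -t' * x' + 2 * s * y' +
      2 * (-2 * p * x' - q * t' - 4 * p * q + s * (y - y')) := by
    rw [e1, e2]; ring
  rw [this]; exact (Int.dvd_add_left (Dvd.intro _ rfl))

lemma t_shift (z z' w w' : Z5) (h : (Z5.comb (-1) z 1 z').lat) (h' : (Z5.comb (-1) w 1 w').lat) :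
    4 ∣ z.t w - z'.t w' := by
  obtain ⟨a, b, c, d, e⟩ := z
  obtain ⟨a', b', c', d', e'⟩ := z'
  obtain ⟨f, g, i, j, k⟩ := w
  obtain ⟨f', g', i', j', k'⟩ := w'
  obtain ⟨⟨p1, h1⟩, ⟨p2, h2⟩, ⟨p3, h3⟩, ⟨p4, h4⟩, ⟨p5, h5⟩⟩ := h
  obtain ⟨⟨q1, g1⟩, ⟨q2, g2⟩, ⟨q3, g3⟩, ⟨q4, g4⟩, ⟨q5, g5⟩⟩ := h'
  simp only [Z5.comb, Z5.t] at *
  obtain rfl : a' = a + 4 * p1 := by linarith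
  obtain rfl : b' = b + 4 * p2 := by linarith
  obtain rfl : c' = c + 2 * p3 := by linarith
  obtain rfl : d' = d + 4 * p4 := by linarith
  obtain rfl : e' = e + 4 * p5 := by linarith
  obtain rfl : f' = f + 4 * q1 := by linarith
  obtain rfl : g' = g + 4 * q2 := by linarith
  obtain rfl : i' = i + 2 * q3 := by linarith
  obtain rfl : j' = j + 4 * q4 := by linarith
  obtain rfl : k' = k + 4 * q5 := by linarith
  refine ⟨-(a * q5 + p1 * k + 4 * p1 * q5 + b * q4 + p2 * j + 4 * p2 * q4 + d * q2 + p4 * g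
    + 4 * p4 * q2 + e * q1 + p5 * f + 4 * p5 * q1 + c * q3 + p3 * i + 2 * p3 * q3), ?_⟩
  ring

lemma C_shift (z z' w w' : Z5) (h : (Z5.comb (-1) z 1 z').lat) (h' : (Z5.comb (-1) w 1 w').lat) :
    z.C w ↔ z'.C w' := by
  have ht := t_shift z z' w w' h h'
  obtain ⟨h1, h2, h3, h4, h5⟩ := h
  obtain ⟨g1, g2, g3, g4, g5⟩ := h'
  simp only [Z5.comb] at h1 h2 h3 h4 h5 g1 g2 g3 g4 g5
  have key : ∀ m : ℤ, 2 ∣ m → ((Z5.comb (-(z.t w)) z m w).lat ↔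
      (Z5.comb (-(z'.t w')) z' m w').lat) := by
    intro m hm
    simp only [Z5.comb, Z5.lat]
    rw [mul_dvd_shift _ _ z.a z'.a m w.a w'.a ht (by omega) (by omega) hm,
      mul_dvd_shift _ _ z.b z'.b m w.b w'.b ht (by omega) (by omega) hm,
      mul_dvd_shift _ _ z.d z'.d m w.d w'.d ht (by omega) (by omega) hm,
      mul_dvd_shift _ _ z.e z'.e m w.e w'.e ht (by omega) (by omega) hm,
      mul_dvd_shift2 _ _ z.c z'.c m w.c w'.c ht (by omega) hm]
  simp only [Z5.C, key 0 (by norm_num), key 2 (by norm_num)]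

lemma C_neg_left (z w : Z5) : z.neg.C w ↔ z.C w := by
  have : z.neg.t w = - z.t w := by simp only [Z5.t, Z5.neg]; ring
  simp only [Z5.C, this]
  simp [Z5.comb, Z5.neg]

lemma C_neg_right (z w : Z5) : z.C w.neg ↔ z.C w := by
  have : z.t w.neg = - z.t w := by simp only [Z5.t, Z5.neg]; ring
  simp only [Z5.C, this, Z5.lat]
  simp only [Z5.comb, Z5.neg, neg_neg, neg_mul]
  generalize z.t w * z.a = p1
  generalize z.t w * z.b = p2
  generalize z.t w * z.c = p3
  generalize z.t w * z.d = p4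
  generalize z.t w * z.e = p5
  omega

lemma same_cases (z w : Z5) (h : z.same w) :
    (Z5.comb (-1) z 1 w).lat ∨ (Z5.comb (-1) z 1 w.neg).lat := by
  rcases h with h | h
  · exact Or.inl h
  · right
    simp only [Z5.comb, Z5.lat, Z5.neg] at h ⊢
    omega

lemma C_same (z z' w w' : Z5) (h : z.same z') (h' : w.same w') : z.C w ↔ z'.C w' := by
  rcases same_cases _ _ h with h | h <;> rcases same_cases _ _ h' with h' | h' <;>
    rw [C_shift _ _ _ _ h h'] <;> simp only [C_neg_left, C_neg_right]

/-- Representatives of the 60 type II classes. -/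
def tab : List Z5 :=
  [⟨0, 0, -1, 0, -1⟩, ⟨0, 0, -1, -1, 0⟩, ⟨0, 0, -1, -1, -1⟩, ⟨0, 0, -1, -1, -2⟩,
   ⟨0, 0, -1, -1, 1⟩, ⟨0, 0, -1, -2, -1⟩, ⟨0, -1, 0, -1, 0⟩, ⟨0, -1, 0, -1, -1⟩,
   ⟨0, -1, 0, -1, -2⟩, ⟨0, -1, 0, -1, 1⟩, ⟨0, -1, -1, 0, 0⟩, ⟨0, -1, -1, 0, -1⟩,
   ⟨0, -1, -1, 0, -2⟩, ⟨0, -1, -1, 0, 1⟩, ⟨0, -2, -1, 0, -1⟩, ⟨-4, -2, -1, -2, 1⟩,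
   ⟨-1, 0, 0, 0, -1⟩, ⟨-1, 0, 0, -1, -1⟩, ⟨-1, 0, 0, -2, -1⟩, ⟨-1, 0, 0, 1, -1⟩,
   ⟨-1, 0, -1, 0, 0⟩, ⟨-1, 0, -1, -1, 0⟩, ⟨-1, 0, -1, -2, 0⟩, ⟨-1, 0, -1, 1, 0⟩,
   ⟨-1, -1, 0, 0, -1⟩, ⟨-1, -1, 0, -1, 0⟩, ⟨-1, -1, 0, -2, 1⟩, ⟨-1, -1, 0, 1, -2⟩,
   ⟨-1, -1, -1, 0, 0⟩, ⟨-1, -1, -1, -1, 1⟩, ⟨-1, -1, -1, -2, 2⟩, ⟨-1, -1, -1, 1, -1⟩,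
   ⟨-1, -2, 0, 0, -1⟩, ⟨-1, -2, 0, -1, 1⟩, ⟨-1, -2, -2, 2, -1⟩, ⟨-1, 2, 0, 1, 1⟩,
   ⟨-1, -2, -1, 0, 0⟩, ⟨-1, -2, -1, -1, 2⟩, ⟨-1, -2, -1, -2, 4⟩, ⟨-1, -2, -1, 1, -2⟩,
   ⟨-1, 1, 0, 0, -1⟩, ⟨-1, 1, 0, -1, -2⟩, ⟨-1, 1, 0, 2, 1⟩, ⟨-1, 1, 0, 1, 0⟩,
   ⟨-1, 1, -1, 0, 0⟩, ⟨-1, 1, -1, -1, -1⟩, ⟨-1, 1, -1, -2, -2⟩, ⟨-1, 1, -1, 1, 1⟩,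
   ⟨-2, 0, -1, -1, 0⟩, ⟨-2, -4, -1, -1, 2⟩, ⟨-2, -1, 0, -1, 0⟩, ⟨-2, -1, -2, -1, 2⟩,
   ⟨-2, -1, 0, 1, -1⟩, ⟨-2, 1, 0, -1, -1⟩, ⟨-2, -1, -1, 0, 0⟩, ⟨-2, -1, -1, -4, 2⟩,
   ⟨-2, -1, -1, 2, -1⟩, ⟨-2, -1, -1, -2, 1⟩, ⟨-2, 2, -1, -1, -1⟩, ⟨-2, -2, -1, -1, 1⟩]

lemma tab_length : tab.length = 60 := rfl

def tv (i : Fin 60) : Z5 := tab.getD i.val ⟨0, 0, 0, 0, 0⟩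

lemma tv_norm : ∀ i, (tv i).t (tv i) = 2 ∧ (tv i).odd := by decide +kernel

lemma tv_inj : ∀ i j, (tv i).same (tv j) → i = j := by decide +kernel

lemma tv_cover_fin : ∀ a b : Fin 4, ∀ c : Fin 2, ∀ d e : Fin 4,
    (a.val * e.val + b.val * d.val + c.val * c.val) % 4 = 1 →
    (Z5.mk a.val b.val c.val d.val e.val).odd →
    ∃ i, (Z5.mk a.val b.val c.val d.val e.val).same (tv i) := by decide +kernel

/-- The adjacency relation, as bit masks. -/
def masks : List ℕ :=
  [1135751531027547105, 865536584178450442, 865552050086264852, 865535617825554442,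
   865799436427640852, 882424051987971105, 16926176338608449, 16907337478996609,
   17038105773375809, 16963849796354689, 270287726165726240, 270260130579785760,
   270238054111024160, 270359474689189920, 287104476244918335, 65535,
   38988747349754946, 77150597530919426, 19739598842564866, 153757969778608258,
   37797843621122120, 81770613263305224, 20849970685936904, 149222351431540872,
   333283019811194384, 362556572084740368, 310765421099815056, 433488034290337872,
   329026940403454468, 361678322515642628, 315515961129174148, 434861391252561988,
   37475778011530504, 81425476459896968, 20689532329332808, 148920097947191816,
   38634984397869314, 76988493551634562, 19448505587205186, 153440834005508610,
   616999213697598596, 649655344700072004, 603487989619823108, 722839019029924100,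
   621585022775857296, 650946626101446736, 599066792708015632, 721877920794091792,
   845520146792511, 844424946843711, 3520916077429728, 3421768270300128,
   13582439280690144, 13533348553573344, 54118255522249729, 54061960526920705,
   216210312110701569, 216322902101359617, 864691132733325375, 864971503920218175]

def adj (i j : Fin 60) : Bool := (masks.getD i.val 0).testBit j.val

lemma adj_spec : ∀ i j, adj i j = decide ((tv i).C (tv j)) := by decide +kernel

lemma adj_symm : ∀ i j, adj i j = adj j i := by decide +kernel

lemma adj_self : ∀ i, adj i i = true := by decide +kernel

/-- The 4-cliques as decreasing quadruples. -/
def quads : List (Fin 60 × Fin 60 × Fin 60 × Fin 60) :=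
  (List.finRange 60).flatMap fun i =>
    ((List.finRange 60).filter fun j => decide (j < i) && adj i j).flatMap fun j =>
      ((List.finRange 60).filter fun k => decide (k < j) && (adj i k && adj j k)).flatMap fun k =>
        ((List.finRange 60).filter fun l =>
          decide (l < k) && (adj i l && (adj j l && adj k l))).map fun l => (i, j, k, l)

def toSet (q : Fin 60 × Fin 60 × Fin 60 × Fin 60) : Finset (Fin 60) :=
  {q.1, q.2.1, q.2.2.1, q.2.2.2}

lemma mem_quads (i j k l : Fin 60) : (i, j, k, l) ∈ quads ↔
    (j < i ∧ adj i j = true) ∧ (k < j ∧ adj i k = true ∧ adj j k = true) ∧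
    (l < k ∧ adj i l = true ∧ adj j l = true ∧ adj k l = true) := by
  simp [quads]

lemma quads_length : quads.length = 105 := by decide +kernel

lemma quads_nodup_key :
    ((quads.map toSet).map fun T => T.sum fun i => 2 ^ i.val).Nodup := by decide +kernel

lemma quads_nodup : (quads.map toSet).Nodup := quads_nodup_key.of_map _

lemma tv_cover (z : Z5) (h : z.t z = 2) (ho : z.odd) : ∃ i, z.same (tv i) := by
  obtain ⟨a, b, c, d, e⟩ := z
  have red : ∀ x n : ℤ, 0 < n → ∃ y : ℕ, (y : ℤ) < n ∧ ∃ k, x = y + n * k := by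
    intro x n hn
    refine ⟨(x % n).toNat, ?_, x / n, ?_⟩
    · rw [Int.toNat_of_nonneg (Int.emod_nonneg _ hn.ne')]
      exact Int.emod_lt_of_pos _ hn
    · rw [Int.toNat_of_nonneg (Int.emod_nonneg _ hn.ne')]
      exact (Int.emod_add_mul_ediv x n).symm
  obtain ⟨a0, ha, ka, rfl⟩ := red a 4 (by norm_num)
  obtain ⟨b0, hb, kb, rfl⟩ := red b 4 (by norm_num)
  obtain ⟨c0, hc, kc, rfl⟩ := red c 2 (by norm_num)
  obtain ⟨d0, hd, kd, rfl⟩ := red d 4 (by norm_num)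
  obtain ⟨e0, he, ke, rfl⟩ := red e 4 (by norm_num)
  have hn : (a0 * e0 + b0 * d0 + c0 * c0) % 4 = 1 := by
    simp only [Z5.t] at h
    have : ((a0 * e0 + b0 * d0 + c0 * c0 : ℕ) : ℤ) = 1 + 4 * (-(a0 * ke + ka * e0 + 4 * ka * ke
      + b0 * kd + kb * d0 + 4 * kb * kd + c0 * kc + kc * kc)) := by
      push_cast
      linarith
    omega
  obtain ⟨i, hi⟩ := tv_cover_fin ⟨a0, by omega⟩ ⟨b0, by omega⟩ ⟨c0, by omega⟩ ⟨d0, by omega⟩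
    ⟨e0, by omega⟩ hn (by simp only [Z5.odd] at ho ⊢; omega)
  refine ⟨i, ?_⟩
  simp only [Z5.same, Z5.lat, Z5.comb] at hi ⊢
  omega

/-- The enumeration of type II classes. -/
def fcls (i : Fin 60) : Sym2 QA := cls (tv i)

lemma fcls_inj : Function.Injective fcls := fun i j h => tv_inj i j ((cls_eq _ _).1 h)

lemma norm_iff (z : Z5) : BA (emb z) (emb z) = 1 / 2 ↔ z.t z = 2 := by
  rw [BA_emb]
  constructor
  · intro h
    have : (z.t z : ℚ) = 2 := by linarith
    exact_mod_cast this
  · intro h; rw [h]; norm_num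

lemma typeII_iff (c : Sym2 QA) : IsTypeII c ↔ ∃ i, c = fcls i := by
  constructor
  · rintro ⟨u, hu, ho, hn, rfl⟩
    obtain ⟨z, rfl⟩ := (mem_dual u).1 hu
    obtain ⟨i, hi⟩ := tv_cover z ((norm_iff z).1 hn) ((order_iff z).1 ho)
    exact ⟨i, (cls_eq _ _).2 hi⟩
  · rintro ⟨i, rfl⟩
    exact ⟨emb (tv i), (mem_dual _).2 ⟨_, rfl⟩, (order_iff _).2 (tv_norm i).2,
      (norm_iff _).2 (tv_norm i).1, rfl⟩

lemma star_iff (S : Set (Sym2 QA)) : IsStarSet S ↔ ∃ T : Finset (Fin 60),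
    (T.card = 4 ∧ ∀ i ∈ T, ∀ j ∈ T, adj i j = true) ∧ fcls '' (T : Set (Fin 60)) = S := by
  classical
  constructor
  · rintro ⟨hcard, htype, hrefl⟩
    have hS : fcls '' (fcls ⁻¹' S) = S := by
      rw [Set.image_preimage_eq_iff]
      intro c hc
      obtain ⟨i, rfl⟩ := (typeII_iff c).1 (htype c hc)
      exact ⟨i, rfl⟩
    refine ⟨(fcls ⁻¹' S).toFinset, ⟨?_, ?_⟩, by rw [Set.coe_toFinset, hS]⟩
    · rw [← Set.ncard_eq_toFinset_card', ← Set.ncard_image_of_injective _ fcls_inj, hS, hcard]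
    · intro i hi j hj
      simp only [Set.mem_toFinset, Set.mem_preimage] at hi hj
      rw [adj_spec]
      refine decide_eq_true ((refl_cond _ _).1 (hrefl _ _ ((mem_dual _).2 ⟨_, rfl⟩)
        ((mem_dual _).2 ⟨_, rfl⟩) ((norm_iff _).2 (tv_norm i).1) ((norm_iff _).2 (tv_norm j).1)
        ⟨_, hi, by simp [fcls, cls]⟩ ⟨_, hj, by simp [fcls, cls]⟩))
  · rintro ⟨T, ⟨hcard, hadj⟩, rfl⟩
    refine ⟨?_, ?_, ?_⟩
    · rw [Set.ncard_image_of_injective _ fcls_inj, Set.ncard_coe_finset, hcard]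
    · rintro _ ⟨i, -, rfl⟩
      exact (typeII_iff _).2 ⟨i, rfl⟩
    · rintro u u' hu hu' - - ⟨_, ⟨i, hi, rfl⟩, hui⟩ ⟨_, ⟨j, hj, rfl⟩, huj⟩
      obtain ⟨z, rfl⟩ := (mem_dual u).1 hu
      obtain ⟨w, rfl⟩ := (mem_dual u').1 hu'
      rw [refl_cond, C_same z (tv i) w (tv j) ((mem_cls _ _).1 hui) ((mem_cls _ _).1 huj)]
      exact of_decide_eq_true ((adj_spec i j).symm.trans (hadj i hi j hj))

lemma clique_iff (T : Finset (Fin 60)) :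
    (T.card = 4 ∧ ∀ i ∈ T, ∀ j ∈ T, adj i j = true) ↔ T ∈ quads.map toSet := by
  rw [List.mem_map]
  constructor
  · rintro ⟨hcard, hadj⟩
    let o := T.orderEmbOfFin hcard
    have ho : ∀ x, o x ∈ T := fun x => T.orderEmbOfFin_mem hcard x
    refine ⟨(o 3, o 2, o 1, o 0), ?_, ?_⟩
    · rw [mem_quads]
      refine ⟨⟨?_, ?_⟩, ⟨?_, ?_, ?_⟩, ?_, ?_, ?_, ?_⟩ <;>
        first
        | exact hadj _ (ho _) _ (ho _)
        | exact o.strictMono (by decide)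
    · apply Finset.eq_of_subset_of_card_le
      · intro x hx
        simp only [toSet, Finset.mem_insert, Finset.mem_singleton] at hx
        rcases hx with rfl | rfl | rfl | rfl <;> exact ho _
      · have : toSet (o 3, o 2, o 1, o 0) = Finset.univ.map o.toEmbedding := by
          ext x
          simp [toSet, Fin.exists_fin_succ]
          grind
        rw [this, hcard]; simp
  · rintro ⟨⟨i, j, k, l⟩, hq, rfl⟩
    rw [mem_quads] at hq
    obtain ⟨⟨h1, h2⟩, ⟨h3, h4, h5⟩, h6, h7, h8, h9⟩ := hq
    constructor
    · have e1 := h3.trans h1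
      have e2 := h6.trans h3
      have e3 := h6.trans e1
      simp [toSet, h1.ne', h3.ne', h6.ne', e1.ne', e2.ne', e3.ne']
    · intro x hx y hy
      have h2sym := (adj_symm _ _).symm.trans h2
      have h4sym := (adj_symm _ _).symm.trans h4
      have h5sym := (adj_symm _ _).symm.trans h5
      have h7sym := (adj_symm _ _).symm.trans h7
      have h8sym := (adj_symm _ _).symm.trans h8
      have h9sym := (adj_symm _ _).symm.trans h9
      simp only [toSet, Finset.mem_insert, Finset.mem_singleton] at hx hy
      rcases hx with rfl | rfl | rfl | rfl <;> rcases hy with rfl | rfl | rfl | rfl <;>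
        simp only [adj_self, h2, h4, h5, h7, h8, h9, h2sym, h4sym, h5sym, h7sym, h8sym, h9sym]

/-- There are exactly 105 `*`-sets. -/
theorem statement4 : {S : Set (Sym2 QA) | IsStarSet S}.ncard = 105 := by
  classical
  have : {S : Set (Sym2 QA) | IsStarSet S} =
      (fun T : Finset (Fin 60) => fcls '' (T : Set (Fin 60))) '' ((quads.map toSet).toFinset :
        Set (Finset (Fin 60))) := by
    ext S
    simp only [Set.mem_ofPred_eq, star_iff, clique_iff, Set.mem_image, List.coe_toFinset]
  rw [this, Set.ncard_image_of_injective, Set.ncard_coe_finset,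
    List.toFinset_card_of_nodup quads_nodup, List.length_map, quads_length]
  intro T T' h
  exact Finset.coe_injective (fcls_inj.image_injective h)

end
end

section
/- Every type II class belongs to exactly seven *-sets. -/
open Matrix

noncomputable section

def vecA (v : Fin 5 → ℤ) : Fin 5 → ℚ :=
  ![(v 0 : ℚ) / 4, (v 1 : ℚ) / 4, (v 2 : ℚ) / 2, (v 3 : ℚ) / 4, (v 4 : ℚ) / 4]

/-- Four times the bilinear form in integer coordinates. -/
def KA (v w : Fin 5 → ℤ) : ℤ :=
  v 0 * w 4 + v 1 * w 3 + v 3 * w 1 + v 4 * w 0 + 2 * (v 2 * w 2)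

/-- Integer coordinates of vectors in `M`. -/
def ZeroA (v : Fin 5 → ℤ) : Prop := 4 ∣ v 0 ∧ 4 ∣ v 1 ∧ 2 ∣ v 2 ∧ 4 ∣ v 3 ∧ 4 ∣ v 4

instance (v : Fin 5 → ℤ) : Decidable (ZeroA v) := by unfold ZeroA; infer_instance

/-- Star relation in integer coordinates. -/
def StarA (v w : Fin 5 → ℤ) : Prop :=
  ZeroA (KA v w • v) ∨ ZeroA ((2 : ℤ) • w - KA v w • v)

instance (v w : Fin 5 → ℤ) : Decidable (StarA v w) := by unfold StarA; infer_instance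

def OddA (v : Fin 5 → ℤ) : Prop := v 0 % 2 = 1 ∨ v 1 % 2 = 1 ∨ v 3 % 2 = 1 ∨ v 4 % 2 = 1

lemma BA_expand (x y : Fin 5 → ℚ) :
    BA x y = 4 * (x 0 * y 4 + x 1 * y 3 + x 3 * y 1 + x 4 * y 0) + 2 * (x 2 * y 2) := by
  simp [BA, GramA, dotProduct, Matrix.mulVec, Fin.sum_univ_five]
  ring

lemma BA_vec (v w : Fin 5 → ℤ) : BA (vecA v) (vecA w) = (KA v w : ℚ) / 4 := by
  rw [BA_expand]
  simp [vecA, KA]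
  ring

lemma BA_half (v : Fin 5 → ℤ) : BA (vecA v) (vecA v) = 1 / 2 ↔ KA v v = 2 := by
  rw [BA_vec]
  constructor
  · intro h
    have : (KA v v : ℚ) = 2 := by linarith
    exact_mod_cast this
  · intro h
    rw [h]; norm_num

lemma vecA_add (v w : Fin 5 → ℤ) : vecA (v + w) = vecA v + vecA w := by
  ext i; fin_cases i <;> simp [vecA] <;> ring

lemma vecA_neg (v : Fin 5 → ℤ) : vecA (-v) = -vecA v := by
  ext i; fin_cases i <;> simp [vecA] <;> ring

lemma vecA_sub (v w : Fin 5 → ℤ) : vecA (v - w) = vecA v - vecA w := by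
  rw [sub_eq_add_neg, vecA_add, vecA_neg, sub_eq_add_neg]

lemma vecA_smul (k : ℤ) (v : Fin 5 → ℤ) : vecA (k • v) = (k : ℚ) • vecA v := by
  ext i; fin_cases i <;> simp [vecA] <;> ring

lemma vecA_mem (v : Fin 5 → ℤ) : vecA v ∈ MA ↔ ZeroA v := by
  change (∀ i, ∃ n : ℤ, vecA v i = (n : ℚ)) ↔ _
  rw [Fin.forall_fin_succ, Fin.forall_fin_succ, Fin.forall_fin_succ, Fin.forall_fin_succ,
    Fin.forall_fin_one]
  unfold ZeroA
  rw [← int_div_four, ← int_div_four, ← int_div_four, ← int_div_four, ← int_div_two]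
  rfl

lemma vecA_dual (v : Fin 5 → ℤ) : vecA v ∈ MAdual := by
  intro m hm
  have hm' : ∀ i, ∃ n : ℤ, m i = (n : ℚ) := hm
  choose f hf using hm'
  refine ⟨v 0 * f 4 + v 1 * f 3 + v 3 * f 1 + v 4 * f 0 + v 2 * f 2, ?_⟩
  rw [BA_expand]
  simp only [hf]
  simp [vecA]
  ring

lemma dual_vec (u : Fin 5 → ℚ) (hu : u ∈ MAdual) : ∃ v, u = vecA v := by
  have key : ∀ j : Fin 5, ∃ n : ℤ, BA u (Pi.single j 1) = n := by
    intro j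
    apply hu
    intro i
    by_cases h : i = j
    · subst h; exact ⟨1, by simp⟩
    · exact ⟨0, by simp [h]⟩
  obtain ⟨n0, h0⟩ := key 0
  obtain ⟨n1, h1⟩ := key 1
  obtain ⟨n2, h2⟩ := key 2
  obtain ⟨n3, h3⟩ := key 3
  obtain ⟨n4, h4⟩ := key 4
  rw [BA_expand] at h0 h1 h2 h3 h4
  simp at h0 h1 h2 h3 h4
  refine ⟨![n4, n3, n2, n1, n0], ?_⟩
  ext i
  fin_cases i <;> simp [vecA] <;> linarith

lemma pA_eq_s5 (v w : Fin 5 → ℤ) : pA (vecA v) = pA (vecA w) ↔ ZeroA (v - w) := by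
  unfold pA
  rw [eq_comm, QuotientAddGroup.eq, ← vecA_mem, vecA_sub]
  have : -vecA w + vecA v = vecA v - vecA w := by abel
  rw [this]

lemma pA_eq_iff (x y : Fin 5 → ℚ) : pA x = pA y ↔ x - y ∈ MA := by
  unfold pA
  rw [eq_comm, QuotientAddGroup.eq]
  have : -y + x = x - y := by abel
  rw [this]

lemma order_vec (v : Fin 5 → ℤ) : addOrderOf (pA (vecA v)) = 4 ↔ OddA v := by
  have hz : ∀ k : ℕ, k • pA (vecA v) = 0 ↔ ZeroA ((k : ℤ) • v) := by
    intro k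
    have : k • pA (vecA v) = ((k • vecA v : Fin 5 → ℚ) : QA) := rfl
    rw [this, QuotientAddGroup.eq_zero_iff, ← vecA_mem, vecA_smul]
    simp [← Nat.cast_smul_eq_nsmul ℚ]
  constructor
  · intro h
    by_contra hodd
    have h2 : 2 • pA (vecA v) = 0 := by
      rw [hz]
      simp only [OddA] at hodd
      simp only [ZeroA, Pi.smul_apply, smul_eq_mul]
      push_cast
      omega
    have := addOrderOf_dvd_of_nsmul_eq_zero h2
    rw [h] at this
    omega
  · intro h
    have : addOrderOf (pA (vecA v)) = 2 ^ (1 + 1) := by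
      apply addOrderOf_eq_prime_pow
      · rw [hz]
        simp only [OddA] at h
        simp only [ZeroA, Pi.smul_apply, smul_eq_mul]
        push_cast
        omega
      · rw [hz]
        simp only [ZeroA, Pi.smul_apply, smul_eq_mul]
        push_cast
        omega
    simpa using this

lemma star_iff_s5 (v w : Fin 5 → ℤ) :
    (reflA (vecA v) (vecA w) - vecA w ∈ MA ∨ reflA (vecA v) (vecA w) + vecA w ∈ MA) ↔
      StarA v w := by
  have h1 : reflA (vecA v) (vecA w) - vecA w = -vecA (KA v w • v) := by
    unfold reflA
    rw [BA_vec, vecA_smul]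
    have : 4 * ((KA v w : ℚ) / 4) = KA v w := by ring
    rw [this]; abel
  have h2 : reflA (vecA v) (vecA w) + vecA w = vecA ((2 : ℤ) • w - KA v w • v) := by
    unfold reflA
    rw [BA_vec, vecA_sub, vecA_smul, vecA_smul]
    have : 4 * ((KA v w : ℚ) / 4) = KA v w := by ring
    rw [this]
    push_cast
    rw [two_smul]; abel
  rw [h1, h2, neg_mem_iff, vecA_mem, vecA_mem, StarA]

lemma zero_neg (v : Fin 5 → ℤ) : ZeroA (-v) ↔ ZeroA v := by
  simp [ZeroA]

lemma zero_sub_iff (v w : Fin 5 → ℤ) (h : ZeroA (v - w)) : ZeroA v ↔ ZeroA w := by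
  simp only [ZeroA, Pi.sub_apply] at *
  omega

lemma zero_sub_comm (v w : Fin 5 → ℤ) : ZeroA (v - w) ↔ ZeroA (w - v) := by
  rw [← zero_neg, neg_sub]

lemma KA_congr (v v' w w' : Fin 5 → ℤ) (h : ZeroA (v - v')) (h' : ZeroA (w - w')) :
    4 ∣ KA v w - KA v' w' := by
  obtain ⟨⟨a, ha⟩, ⟨b, hb⟩, ⟨c, hc⟩, ⟨d, hd⟩, ⟨e, he⟩⟩ := h
  obtain ⟨⟨a', ha'⟩, ⟨b', hb'⟩, ⟨c', hc'⟩, ⟨d', hd'⟩, ⟨e', he'⟩⟩ := h'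
  simp only [Pi.sub_apply, sub_eq_iff_eq_add] at *
  unfold KA
  rw [ha, hb, hc, hd, he, ha', hb', hc', hd', he']
  exact ⟨_, by
    rw [show ∀ X : ℤ, X = 4 * (a * (4 * e' + w' 4) + v' 0 * e' + b * (4 * d' + w' 3) + v' 1 * d'
      + d * (4 * b' + w' 1) + v' 3 * b' + e * (4 * a' + w' 0) + v' 4 * a'
      + c * (2 * c' + w' 2) + v' 2 * c') ↔ X = 4 * _ from fun _ => Iff.rfl]
    ring⟩

lemma smul_congr (k k' : ℤ) (v v' : Fin 5 → ℤ) (hk : 4 ∣ k - k') (h : ZeroA (v - v')) :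
    ZeroA (k • v - k' • v') := by
  obtain ⟨t, ht⟩ := hk
  obtain ⟨⟨a, ha⟩, ⟨b, hb⟩, ⟨c, hc⟩, ⟨d, hd⟩, ⟨e, he⟩⟩ := h
  simp only [Pi.sub_apply, sub_eq_iff_eq_add] at *
  simp only [ZeroA, Pi.sub_apply, Pi.smul_apply, smul_eq_mul]
  rw [ha, hb, hc, hd, he, ht]
  exact ⟨⟨(4 * t + k') * a + t * v' 0, by ring⟩, ⟨(4 * t + k') * b + t * v' 1, by ring⟩,
    ⟨(4 * t + k') * c + 2 * t * v' 2, by ring⟩, ⟨(4 * t + k') * d + t * v' 3, by ring⟩,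
    ⟨(4 * t + k') * e + t * v' 4, by ring⟩⟩

lemma star_congr (v v' w w' : Fin 5 → ℤ) (h : ZeroA (v - v')) (h' : ZeroA (w - w')) :
    StarA v w ↔ StarA v' w' := by
  have hK := KA_congr v v' w w' h h'
  have h1 := smul_congr _ _ v v' hK h
  have h2 := smul_congr 2 2 w w' (by simp) h'
  unfold StarA
  refine or_congr (zero_sub_iff _ _ h1) (zero_sub_iff _ _ ?_)
  simp only [ZeroA, Pi.sub_apply] at *
  omega

lemma star_neg_left (v w : Fin 5 → ℤ) : StarA (-v) w ↔ StarA v w := by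
  have : KA (-v) w = -KA v w := by simp [KA]; ring
  unfold StarA
  rw [this]; simp

lemma star_neg_right (v w : Fin 5 → ℤ) : StarA v (-w) ↔ StarA v w := by
  have : KA v (-w) = -KA v w := by simp [KA]; ring
  unfold StarA
  rw [this, neg_smul, zero_neg]
  have : (2 : ℤ) • (-w) - -(KA v w • v) = -((2 : ℤ) • w - KA v w • v) := by
    rw [smul_neg]; abel
  rw [this, zero_neg]

def encA (v : Fin 5 → ℤ) : ℕ :=
  (v 0 % 4 + 4 * (v 1 % 4) + 16 * (v 3 % 4) + 64 * (v 4 % 4) + 256 * (v 2 % 2)).toNat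

def decA (n : ℕ) : Fin 5 → ℤ :=
  ![((n % 4 : ℕ) : ℤ), ((n / 4 % 4 : ℕ) : ℤ), ((n / 256 % 2 : ℕ) : ℤ),
    ((n / 16 % 4 : ℕ) : ℤ), ((n / 64 % 4 : ℕ) : ℤ)]

def goodA (n : ℕ) : Bool :=
  ((n % 4) * (n / 64 % 4) + (n / 4 % 4) * (n / 16 % 4) + (n / 256 % 2) * (n / 256 % 2)) % 4 == 1 &&
  (n % 2 == 1 || n / 4 % 2 == 1 || n / 16 % 2 == 1 || n / 64 % 2 == 1)

def negA (n : ℕ) : ℕ :=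
  (4 - n % 4) % 4 + 4 * ((4 - n / 4 % 4) % 4) + 16 * ((4 - n / 16 % 4) % 4) +
    64 * ((4 - n / 64 % 4) % 4) + 256 * (n / 256 % 2)

def PA : Finset ℕ := (Finset.range 512).filter fun n => goodA n && Nat.ble n (negA n)

def relA (m n : ℕ) : Bool :=
  let k := ((m % 4) * (n / 64 % 4) + (m / 4 % 4) * (n / 16 % 4) + (m / 16 % 4) * (n / 4 % 4) +
    (m / 64 % 4) * (n % 4) + 2 * ((m / 256 % 2) * (n / 256 % 2))) % 4
  k == 0 || (k == 2 && m % 2 == n % 2 && m / 4 % 2 == n / 4 % 2 && m / 16 % 2 == n / 16 % 2 &&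
    m / 64 % 2 == n / 64 % 2)

def liftA (n : ℕ) : Fin 5 → ℤ :=
  let s : ℤ → ℤ := fun x => if x = 1 then 1 else -1
  let a := decA n 0
  let b := decA n 1
  let c := decA n 2
  let d := decA n 3
  let e := decA n 4
  if a % 2 = 1 then ![s a, b, c, d, s a * (1 - c * c - b * d)]
  else if b % 2 = 1 then ![a, s b, c, s b * (1 - c * c - a * e), e]
  else if d % 2 = 1 then ![a, s d * (1 - c * c - a * e), c, s d, e]
  else ![s e * (1 - c * c - b * d), b, c, d, s e]

/-- The elements of `PA` as an explicit list. -/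
def listA : List ℕ := [
  20, 21, 22, 23, 65, 69, 73, 77, 81, 84, 91, 94, 97, 103, 105, 111, 113, 118, 123, 124,
  148, 150, 157, 159, 257, 260, 261, 262, 263, 265, 272, 273, 274, 275, 289, 297, 320, 324,
  328, 332, 336, 343, 346, 349, 352, 358, 360, 366, 368, 373, 378, 383, 388, 390, 400, 402,
  409, 411, 421, 423]

lemma mem_PA_iff (n : ℕ) : n ∈ PA ↔ n ∈ listA := by
  have h : (List.range 512).filter (fun n => goodA n && Nat.ble n (negA n)) = listA := by
    decide +kernel
  rw [← h]
  simp [PA]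

lemma lift_spec : ∀ n ∈ PA, encA (liftA n) = n ∧ KA (liftA n) (liftA n) = 2 := by
  simp only [mem_PA_iff]
  decide +kernel

lemma rel_spec : ∀ m ∈ PA, ∀ n ∈ PA, (relA m n = true ↔ StarA (decA m) (decA n)) := by
  simp only [mem_PA_iff]
  decide +kernel

lemma rel_symm : ∀ m ∈ PA, ∀ n ∈ PA, relA m n = relA n m := by
  simp only [mem_PA_iff]
  decide +kernel

lemma rel_self : ∀ m ∈ PA, relA m m = true := by
  simp only [mem_PA_iff]
  decide +kernel

lemma neg_enc_mem : ∀ n ∈ PA, encA (-decA n) ∈ PA → encA (-decA n) = n := by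
  simp only [mem_PA_iff]
  decide +kernel

lemma neg_enc (m : ℕ) (hm : m ∈ PA) (n : ℕ) (hn : n ∈ PA) (h : m = encA (-decA n)) : m = n := by
  rw [h] at hm ⊢
  exact neg_enc_mem n hn hm

lemma enc_dec : ∀ n ∈ PA, encA (decA n) = n := by
  simp only [mem_PA_iff]
  decide +kernel

def cliqueA (G : Finset ℕ) : Prop := ∀ m ∈ G, ∀ n ∈ G, relA m n = true

instance (G : Finset ℕ) : Decidable (cliqueA G) := by unfold cliqueA; infer_instance

def nbrA (i : ℕ) : Finset ℕ := PA.filter fun j => relA i j && !(Nat.beq i j)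

def triplesA (i : ℕ) : Finset (Finset ℕ) :=
  ((nbrA i).powersetCard 3).filter fun G => cliqueA G

/-- The number of cliques of size `k` in a list: the cliques avoiding the head and those
containing it. -/
def countA (k : ℕ) : List ℕ → ℕ :=
  Nat.rec (fun _ => 1)
    (fun _ f l => List.rec 0 (fun x xs r => r + f (xs.filter (relA x))) l) k

lemma countA_zero (l : List ℕ) : countA 0 l = 1 := rfl

lemma countA_nil (k : ℕ) : countA (k + 1) [] = 0 := rfl

lemma countA_cons (k x : ℕ) (xs : List ℕ) :
    countA (k + 1) (x :: xs) = countA (k + 1) xs + countA k (xs.filter (relA x)) := rfl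

lemma clique_insert (x : ℕ) (G : Finset ℕ) (hx : x ∈ PA) (hG : G ⊆ PA) :
    cliqueA (insert x G) ↔ (∀ y ∈ G, relA x y = true) ∧ cliqueA G := by
  constructor
  · intro h
    exact ⟨fun y hy => h x (Finset.mem_insert_self _ _) y (Finset.mem_insert_of_mem hy),
      fun m hm n hn => h m (Finset.mem_insert_of_mem hm) n (Finset.mem_insert_of_mem hn)⟩
  · rintro ⟨h1, h2⟩ m hm n hn
    rcases Finset.mem_insert.1 hm with hm1 | hm1 <;> rcases Finset.mem_insert.1 hn with hn1 | hn1
    · rw [hm1, hn1]; exact rel_self x hx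
    · rw [hm1]; exact h1 n hn1
    · rw [hn1, rel_symm m (hG hm1) x hx]; exact h1 m hm1
    · exact h2 m hm1 n hn1

lemma count_spec (k : ℕ) : ∀ l : List ℕ, l.Nodup → (∀ x ∈ l, x ∈ PA) →
    ((l.toFinset.powersetCard k).filter fun G => cliqueA G).card = countA k l := by
  induction k with
  | zero =>
    intro l _ _
    rw [countA_zero, Finset.powersetCard_zero, Finset.filter_singleton,
      if_pos (by simp [cliqueA]), Finset.card_singleton]
  | succ k ihk =>
    intro l
    induction l with
    | nil =>
      intro _ _
      simp [countA_nil]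
    | cons x xs ih =>
      intro hnd hP
      rw [List.nodup_cons] at hnd
      have hxs : ∀ y ∈ xs, y ∈ PA := fun y hy => hP y (List.mem_cons_of_mem _ hy)
      have hx : x ∈ PA := hP x List.mem_cons_self
      have hxn : x ∉ xs.toFinset := by simpa using hnd.1
      rw [countA_cons, ← ih hnd.2 hxs,
        ← ihk (xs.filter (relA x)) (hnd.2.filter _)
          (fun y hy => hxs y (List.mem_of_mem_filter hy)),
        List.toFinset_cons, Finset.powersetCard_succ_insert hxn, Finset.filter_union,
        Finset.card_union_of_disjoint]
      · congr 1
        have himg : ((Finset.powersetCard k xs.toFinset).image (insert x)).filter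
              (fun G => cliqueA G) =
            (((xs.filter (relA x)).toFinset.powersetCard k).filter
              fun G => cliqueA G).image (insert x) := by
          ext G
          simp only [Finset.mem_filter, Finset.mem_image, Finset.mem_powersetCard]
          constructor
          · rintro ⟨⟨H, ⟨hH, hc⟩, rfl⟩, hcl⟩
            have hHP : H ⊆ PA := fun y hy => hxs y (by simpa using hH hy)
            rw [clique_insert x H hx hHP] at hcl
            refine ⟨H, ⟨⟨?_, hc⟩, hcl.2⟩, rfl⟩
            intro y hy
            have := hH hy
            simp at this
            simp [this, hcl.1 y hy]
          · rintro ⟨H, ⟨⟨hH, hc⟩, hcl⟩, rfl⟩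
            have hH1 : ∀ y ∈ H, y ∈ xs ∧ relA x y = true := fun y hy => by
              simpa using hH hy
            have hHP : H ⊆ PA := fun y hy => hxs y (hH1 y hy).1
            refine ⟨⟨H, ⟨fun y hy => by simpa using (hH1 y hy).1, hc⟩, rfl⟩, ?_⟩
            rw [clique_insert x H hx hHP]
            exact ⟨fun y hy => (hH1 y hy).2, hcl⟩
        rw [himg]
        apply Finset.card_image_of_injOn
        have hnot : ∀ H ∈ (((xs.filter (relA x)).toFinset.powersetCard k).filter
              fun G => cliqueA G), x ∉ H := by
          intro H hH hxH
          simp only [Finset.mem_filter, Finset.mem_powersetCard] at hH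
          have := hH.1.1 hxH
          simp at this
          exact hnd.1 this.1
        intro H hH H' hH' h
        have h' : insert x H = insert x H' := h
        rw [← Finset.erase_insert (hnot H hH), h', Finset.erase_insert (hnot H' hH')]
      · rw [Finset.disjoint_left]
        intro G hG hG'
        simp only [Finset.mem_filter, Finset.mem_image, Finset.mem_powersetCard] at hG hG'
        obtain ⟨⟨H, -, rfl⟩, -⟩ := hG'
        exact hxn (hG.1.1 (Finset.mem_insert_self _ _))

lemma count_seven : ∀ i ∈ listA,
    countA 3 (listA.filter fun j => relA i j && !(Nat.beq i j)) = 7 := by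
  decide +kernel

lemma triples_card (i : ℕ) (hi : i ∈ PA) : (triplesA i).card = 7 := by
  rw [mem_PA_iff] at hi
  rw [← count_seven i hi, ← count_spec]
  · have hset : nbrA i = (listA.filter fun j => relA i j && !(Nat.beq i j)).toFinset := by
      ext j
      rw [List.mem_toFinset, List.mem_filter, nbrA, Finset.mem_filter, mem_PA_iff]
    rw [triplesA, hset]
  · have : listA.Nodup := by decide +kernel
    exact this.filter _
  · intro j hj
    rw [mem_PA_iff]
    exact List.mem_of_mem_filter hj

lemma enc_eq (v w : Fin 5 → ℤ) : encA v = encA w ↔ ZeroA (v - w) := by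
  simp only [encA, ZeroA, Pi.sub_apply]
  omega

lemma dec_enc (v : Fin 5 → ℤ) : ZeroA (decA (encA v) - v) := by
  simp only [encA, ZeroA, Pi.sub_apply, decA]
  simp
  omega

lemma enc_lt (v : Fin 5 → ℤ) : encA v < 512 := by
  simp only [encA]
  omega

lemma neg_A_enc (v : Fin 5 → ℤ) : negA (encA v) = encA (-v) := by
  have h0 := dec_enc v
  have hlt := enc_lt v
  have h1 : negA (encA v) = encA (-decA (encA v)) := by
    have : ∀ n < 512, negA n = encA (-decA n) := by decide +kernel
    exact this _ hlt
  rw [h1, enc_eq, ← zero_neg]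
  have : -(-decA (encA v) - -v) = decA (encA v) - v := by abel
  rwa [this]

lemma good_enc (v : Fin 5 → ℤ) (h : KA v v = 2) (ho : OddA v) : goodA (encA v) = true := by
  have h1 := dec_enc v
  have h3 : 2 * (v 0 * v 4 + v 1 * v 3 + v 2 * v 2) = 2 := by
    have h' := h
    rw [KA] at h'
    linarith
  set n := encA v with hn
  have hc : (4 : ℤ) ∣ (decA n 0 * decA n 4 + decA n 1 * decA n 3 + decA n 2 * decA n 2)
      - (v 0 * v 4 + v 1 * v 3 + v 2 * v 2) := by
    obtain ⟨⟨a, ha⟩, ⟨b, hb⟩, ⟨c, hc⟩, ⟨d, hd⟩, ⟨e, he⟩⟩ := h1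
    simp only [Pi.sub_apply, sub_eq_iff_eq_add] at *
    rw [ha, hb, hc, hd, he]
    exact ⟨4 * a * e + a * v 4 + e * v 0 + 4 * b * d + b * v 3 + d * v 1 + c * c + c * v 2, by ring⟩
  have h4 : (4 : ℤ) ∣ (decA n 0 * decA n 4 + decA n 1 * decA n 3 + decA n 2 * decA n 2) - 1 := by
    have : v 0 * v 4 + v 1 * v 3 + v 2 * v 2 = 1 := by linarith
    rwa [this] at hc
  have h5 : ((n % 4) * (n / 64 % 4) + (n / 4 % 4) * (n / 16 % 4)
      + (n / 256 % 2) * (n / 256 % 2)) % 4 = 1 := by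
    have h6 : (4 : ℤ) ∣ (((n % 4) * (n / 64 % 4) + (n / 4 % 4) * (n / 16 % 4)
      + (n / 256 % 2) * (n / 256 % 2) : ℕ) : ℤ) - 1 := by
      rw [Nat.cast_add, Nat.cast_add, Nat.cast_mul, Nat.cast_mul, Nat.cast_mul]
      exact h4
    generalize ((n % 4) * (n / 64 % 4) + (n / 4 % 4) * (n / 16 % 4)
      + (n / 256 % 2) * (n / 256 % 2)) = X at h6 ⊢
    omega
  have h7 : n % 2 = 1 ∨ n / 4 % 2 = 1 ∨ n / 16 % 2 = 1 ∨ n / 64 % 2 = 1 := by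
    simp only [OddA] at ho
    rw [hn]
    simp only [encA]
    omega
  simp only [goodA, Bool.and_eq_true, Bool.or_eq_true, beq_iff_eq]
  exact ⟨h5, by tauto⟩

lemma mem_PA (v : Fin 5 → ℤ) (h : KA v v = 2) (ho : OddA v) :
    encA v ∈ PA ∨ encA (-v) ∈ PA := by
  have hk : KA (-v) (-v) = 2 := by rw [← h]; simp [KA]
  have ho' : OddA (-v) := by
    simp only [OddA, Pi.neg_apply] at *
    omega
  rcases le_total (encA v) (encA (-v)) with hle | hle
  · left
    simp only [PA, Finset.mem_filter, Finset.mem_range, Bool.and_eq_true, Nat.ble_eq]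
    exact ⟨enc_lt v, good_enc v h ho, by rw [neg_A_enc]; exact hle⟩
  · right
    simp only [PA, Finset.mem_filter, Finset.mem_range, Bool.and_eq_true, Nat.ble_eq]
    exact ⟨enc_lt _, good_enc _ hk ho', by rw [neg_A_enc, neg_neg]; exact hle⟩

/-- The class with code `n`. -/
def clsA (n : ℕ) : Sym2 QA := s(pA (vecA (decA n)), pA (-vecA (decA n)))

lemma cls_enc (v : Fin 5 → ℤ) : clsA (encA v) = s(pA (vecA v), pA (-vecA v)) := by
  have h := dec_enc v
  have h1 : pA (vecA (decA (encA v))) = pA (vecA v) := (pA_eq_s5 _ _).2 h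
  have h2 : pA (-vecA (decA (encA v))) = pA (-vecA v) := by
    rw [← vecA_neg, ← vecA_neg, pA_eq_s5, ← zero_neg]
    have : -(-decA (encA v) - -v) = decA (encA v) - v := by abel
    rwa [this]
  rw [clsA, h1, h2]

lemma cls_typeII (n : ℕ) (hn : n ∈ PA) : IsTypeII (clsA n) := by
  obtain ⟨h1, h2⟩ := lift_spec n hn
  refine ⟨vecA (liftA n), vecA_dual _, ?_, (BA_half _).2 h2, ?_⟩
  · rw [order_vec]
    by_contra ho
    have hg : goodA n = true := by
      simp only [PA, Finset.mem_filter, Bool.and_eq_true] at hn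
      exact hn.2.1
    simp only [goodA, Bool.and_eq_true, Bool.or_eq_true, beq_iff_eq] at hg
    have hg2 := hg.2
    rw [← h1] at hg2
    simp only [encA] at hg2
    simp only [OddA] at ho
    omega
  · rw [← cls_enc, h1]

lemma typeII_cls (c : Sym2 QA) (hc : IsTypeII c) : ∃ n ∈ PA, c = clsA n := by
  obtain ⟨u, hu, ho, hB, rfl⟩ := hc
  obtain ⟨v, rfl⟩ := dual_vec u hu
  rw [order_vec] at ho
  rw [BA_half] at hB
  rcases mem_PA v hB ho with h | h
  · exact ⟨_, h, (cls_enc v).symm⟩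
  · refine ⟨_, h, ?_⟩
    rw [cls_enc, vecA_neg, neg_neg, Sym2.eq_swap]

lemma cls_mem (n : ℕ) (v : Fin 5 → ℤ) :
    pA (vecA v) ∈ clsA n ↔ ZeroA (v - decA n) ∨ ZeroA (v - -decA n) := by
  rw [clsA, Sym2.mem_iff, ← vecA_neg, pA_eq_s5, pA_eq_s5]

lemma cls_inj : Set.InjOn clsA (PA : Set ℕ) := by
  intro m hm n hn h
  have hm' : m ∈ PA := hm
  have hn' : n ∈ PA := hn
  have h1 : pA (vecA (decA m)) ∈ clsA n := by
    rw [← h, clsA]; exact Sym2.mem_mk_left _ _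
  rw [cls_mem, ← enc_eq, ← enc_eq, enc_dec m hm', enc_dec n hn'] at h1
  rcases h1 with h1 | h1
  · exact h1
  · exact neg_enc m hm' n hn' h1

lemma star_cls (m n : ℕ) (v w : Fin 5 → ℤ) (hv : pA (vecA v) ∈ clsA m)
    (hw : pA (vecA w) ∈ clsA n) : StarA v w ↔ StarA (decA m) (decA n) := by
  rw [cls_mem] at hv hw
  rcases hv with hv | hv <;> rcases hw with hw | hw <;> rw [star_congr _ _ _ _ hv hw] <;>
    simp only [star_neg_left, star_neg_right]

lemma isStar_iff (F : Finset ℕ) (hF : F ⊆ PA) :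
    IsStarSet (clsA '' (F : Set ℕ)) ↔ F.card = 4 ∧ cliqueA F := by
  have hinj : Set.InjOn clsA (F : Set ℕ) := cls_inj.mono (by exact_mod_cast hF)
  unfold IsStarSet
  rw [Set.InjOn.ncard_image hinj, Set.ncard_coe_finset]
  refine and_congr_right fun _ => ?_
  constructor
  · rintro ⟨-, h⟩ m hm n hn
    rw [rel_spec m (hF hm) n (hF hn)]
    obtain ⟨m1, m2⟩ := lift_spec m (hF hm)
    obtain ⟨n1, n2⟩ := lift_spec n (hF hn)
    have hm3 : pA (vecA (liftA m)) ∈ clsA m := by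
      have h0 := cls_enc (liftA m)
      rw [m1] at h0
      rw [h0]
      exact Sym2.mem_mk_left _ _
    have hn3 : pA (vecA (liftA n)) ∈ clsA n := by
      have h0 := cls_enc (liftA n)
      rw [n1] at h0
      rw [h0]
      exact Sym2.mem_mk_left _ _
    rw [← star_cls m n _ _ hm3 hn3, ← star_iff_s5]
    exact h _ _ (vecA_dual _) (vecA_dual _) ((BA_half _).2 m2) ((BA_half _).2 n2)
      ⟨_, ⟨m, hm, rfl⟩, hm3⟩ ⟨_, ⟨n, hn, rfl⟩, hn3⟩
  · intro h
    refine ⟨?_, ?_⟩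
    · rintro _ ⟨n, hn, rfl⟩
      exact cls_typeII n (hF hn)
    · rintro u u' hu hu' - - ⟨_, ⟨m, hm, rfl⟩, hm3⟩ ⟨_, ⟨n, hn, rfl⟩, hn3⟩
      obtain ⟨v, rfl⟩ := dual_vec u hu
      obtain ⟨w, rfl⟩ := dual_vec u' hu'
      rw [star_iff_s5, star_cls m n _ _ hm3 hn3, ← rel_spec m (hF hm) n (hF hn)]
      exact h m hm n hn

lemma mem_nbr (i j : ℕ) : j ∈ nbrA i ↔ j ∈ PA ∧ relA i j = true ∧ i ≠ j := by
  simp only [nbrA, Finset.mem_filter, Bool.and_eq_true, Bool.not_eq_true']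
  rw [← Bool.not_eq_true, Nat.beq_eq]

lemma mem_triples (i : ℕ) (G : Finset ℕ) :
    G ∈ triplesA i ↔ G ⊆ nbrA i ∧ G.card = 3 ∧ cliqueA G := by
  simp [triplesA, Finset.mem_powersetCard, and_assoc]

lemma star_image (i : ℕ) (hi : i ∈ PA) :
    {S : Set (Sym2 QA) | IsStarSet S ∧ clsA i ∈ S} =
      (fun G : Finset ℕ => clsA '' ((insert i G : Finset ℕ) : Set ℕ)) ''
        (triplesA i : Set (Finset ℕ)) := by
  ext S
  constructor
  · rintro ⟨hS, hiS⟩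
    classical
    set F : Finset ℕ := PA.filter fun n => clsA n ∈ S with hFdef
    have hFP : F ⊆ PA := Finset.filter_subset _ _
    have hSF : S = clsA '' (F : Set ℕ) := by
      ext c
      constructor
      · intro hc
        obtain ⟨n, hn, rfl⟩ := typeII_cls c (hS.2.1 c hc)
        exact ⟨n, by simp [hFdef, hn, hc], rfl⟩
      · rintro ⟨n, hn, rfl⟩
        simp [hFdef] at hn
        exact hn.2
    have hiF : i ∈ F := by simp [hFdef, hi, hiS]
    rw [hSF, isStar_iff F hFP] at hS
    refine ⟨F.erase i, ?_, ?_⟩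
    · rw [Finset.mem_coe, mem_triples]
      refine ⟨?_, ?_, ?_⟩
      · intro j hj
        have hjF := Finset.mem_of_mem_erase hj
        rw [mem_nbr]
        exact ⟨hFP hjF, hS.2 i hiF j hjF, (Finset.ne_of_mem_erase hj).symm⟩
      · rw [Finset.card_erase_of_mem hiF, hS.1]
      · intro m hm n hn
        exact hS.2 m (Finset.mem_of_mem_erase hm) n (Finset.mem_of_mem_erase hn)
    · simp only
      rw [Finset.insert_erase hiF, hSF]
  · rintro ⟨G, hG, rfl⟩
    rw [Finset.mem_coe, mem_triples] at hG
    obtain ⟨hsub, hcard, hcl⟩ := hG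
    have hiG : i ∉ G := fun h => ((mem_nbr i i).1 (hsub h)).2.2 rfl
    have hsP : insert i G ⊆ PA := by
      intro j hj
      rcases Finset.mem_insert.1 hj with rfl | hj
      · exact hi
      · exact ((mem_nbr i j).1 (hsub hj)).1
    refine ⟨?_, ⟨i, by simp, rfl⟩⟩
    rw [isStar_iff _ hsP]
    refine ⟨by rw [Finset.card_insert_of_notMem hiG, hcard], ?_⟩
    intro m hm n hn
    rcases Finset.mem_insert.1 hm with hm1 | hm1 <;> rcases Finset.mem_insert.1 hn with hn1 | hn1
    · rw [hm1, hn1]; exact rel_self i hi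
    · rw [hm1]; exact ((mem_nbr i n).1 (hsub hn1)).2.1
    · rw [hn1, rel_symm m (hsP hm) i hi]; exact ((mem_nbr i m).1 (hsub hm1)).2.1
    · exact hcl m hm1 n hn1

lemma image_inj (i : ℕ) (hi : i ∈ PA) :
    Set.InjOn (fun G : Finset ℕ => clsA '' ((insert i G : Finset ℕ) : Set ℕ))
      (triplesA i : Set (Finset ℕ)) := by
  have hsub : ∀ G ∈ triplesA i, i ∉ G ∧ ((insert i G : Finset ℕ) : Set ℕ) ⊆ (PA : Set ℕ) := by
    intro G hG
    rw [mem_triples] at hG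
    refine ⟨fun h => ((mem_nbr i i).1 (hG.1 h)).2.2 rfl, ?_⟩
    intro j hj
    rcases Finset.mem_insert.1 (Finset.mem_coe.1 hj) with rfl | hj
    · exact hi
    · exact ((mem_nbr i j).1 (hG.1 hj)).1
  intro G hG G' hG' h
  obtain ⟨h1, h2⟩ := hsub G hG
  obtain ⟨hni, hsb⟩ := hsub G' hG'
  have h3 := (cls_inj.image_eq_image_iff h2 hsb).1 h
  have h4 : insert i G = insert i G' := by exact_mod_cast h3
  rw [← Finset.erase_insert h1, h4, Finset.erase_insert hni]

/-- Every type II class belongs to exactly seven `*`-sets. -/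
theorem statement5 (c : Sym2 QA) (hc : IsTypeII c) :
    {S : Set (Sym2 QA) | IsStarSet S ∧ c ∈ S}.ncard = 7 := by
  obtain ⟨i, hi, rfl⟩ := typeII_cls c hc
  rw [star_image i hi, Set.InjOn.ncard_image (image_inj i hi), Set.ncard_coe_finset]
  exact triples_card i hi

end
end
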